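/- Every zero s ∈ ℂ of the function ξ_+(s) = (1/2)(ξ(s+1/2) + ξ(s−1/2)) satisfies Re s = 1/2. -/

import Mathlib

open Complex

/-- The Riemann xi function: `ξ(s) = (s(s-1)/2)·Λ₀(s) + 1/2`. -/
noncomputable def xi (s : ℂ) : ℂ := s * (s - 1) / 2 * completedRiemannZeta₀ s + 1 / 2

/-- `ξ_r = ξ^{(2r)}(1/2) / (2r)!`. -/
noncomputable def xiCoeff (r : ℕ) : ℂ := iteratedDeriv (2 * r) xi (1 / 2) / ((2 * r).factorial : ℂ)

/-- `ξ₊(s) = (1/2)(ξ(s+1/2) + ξ(s−1/2))`. -/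
noncomputable def xiPlus (s : ℂ) : ℂ := (1 / 2) * (xi (s + 1 / 2) + xi (s - 1 / 2))

/-- `ξ₋(s) = (1/2)(ξ(s+1/2) − ξ(s−1/2))`. -/
noncomputable def xiMinus (s : ℂ) : ℂ := (1 / 2) * (xi (s + 1 / 2) - xi (s - 1 / 2))

/-- The Mellin-type integral `∫₁^∞ {t} t^{-s-1} dt`. -/
noncomputable def fractIntegral (s : ℂ) : ℂ :=
  mellin (Set.indicator (Set.Ioi 1) fun t : ℝ ↦ ((Int.fract t : ℝ) : ℂ)) (-s)

lemma fractIntegral_eq (s : ℂ) :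
    fractIntegral s = ∫ t in Set.Ioi (1 : ℝ), ((Int.fract t : ℝ) : ℂ) * (t : ℂ) ^ (-(s + 1)) := by
  rw [fractIntegral, mellin]
  have : ∀ t : ℝ, (t : ℂ) ^ (-s - 1) • Set.indicator (Set.Ioi (1 : ℝ))
      (fun t : ℝ ↦ ((Int.fract t : ℝ) : ℂ)) t = Set.indicator (Set.Ioi (1 : ℝ))
      (fun t : ℝ ↦ ((Int.fract t : ℝ) : ℂ) * (t : ℂ) ^ (-(s + 1))) t := by
    intro t
    by_cases ht : t ∈ Set.Ioi (1 : ℝ)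
    · simp only [Set.indicator_of_mem ht, smul_eq_mul]
      rw [mul_comm, neg_add']
    · simp [Set.indicator_of_notMem ht]
  simp_rw [this]
  rw [MeasureTheory.setIntegral_indicator measurableSet_Ioi]
  congr 2
  ext t
  simp only [Set.mem_inter_iff, Set.mem_Ioi]
  constructor
  · exact fun h ↦ h.2
  · exact fun h ↦ ⟨by linarith, h⟩

lemma norm_fract_mul_cpow_le {s : ℂ} {t : ℝ} (ht : 0 < t) :
    ‖((Int.fract t : ℝ) : ℂ) * (t : ℂ) ^ (-(s + 1))‖ ≤ t ^ (-(s.re + 1)) := by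
  rw [norm_mul, Complex.norm_cpow_eq_rpow_re_of_pos ht, Complex.norm_real, Real.norm_eq_abs,
    abs_of_nonneg (Int.fract_nonneg t)]
  simpa using mul_le_of_le_one_left (Real.rpow_nonneg ht.le _) (Int.fract_lt_one t).le

lemma norm_fractIntegral_le {s : ℂ} (hs : 0 < s.re) : ‖fractIntegral s‖ ≤ 1 / s.re := by
  rw [fractIntegral_eq]
  refine (MeasureTheory.norm_integral_le_of_norm_le
    (integrableOn_Ioi_rpow_of_lt (a := -(s.re + 1)) (by linarith) one_pos)
    ((MeasureTheory.ae_restrict_iff' measurableSet_Ioi).2 (.of_forall fun t ht ↦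
      norm_fract_mul_cpow_le (zero_lt_one.trans ht)))).trans_eq ?_
  rw [integral_Ioi_rpow_of_lt (by linarith) one_pos]
  simp

lemma integrableOn_fract_mul_cpow {s : ℂ} (hs : 0 < s.re) :
    MeasureTheory.IntegrableOn (fun t : ℝ ↦ ((Int.fract t : ℝ) : ℂ) * (t : ℂ) ^ (-(s + 1)))
      (Set.Ioi 1) := by
  refine MeasureTheory.Integrable.mono'
    (integrableOn_Ioi_rpow_of_lt (a := -(s.re + 1)) (by linarith) one_pos) ?_
    ((MeasureTheory.ae_restrict_iff' measurableSet_Ioi).2 (.of_forall fun t ht ↦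
      norm_fract_mul_cpow_le (zero_lt_one.trans ht)))
  refine MeasureTheory.AEStronglyMeasurable.mul ?_ ?_
  · exact (Complex.measurable_ofReal.comp measurable_fract).aestronglyMeasurable
  · exact (Complex.measurable_ofReal.pow_const _).aestronglyMeasurable

lemma differentiableAt_fractIntegral {s : ℂ} (hs : 0 < s.re) :
    DifferentiableAt ℂ fractIntegral s := by
  have hb : ∀ t : ℝ, ‖Set.indicator (Set.Ioi 1) (fun t : ℝ ↦ ((Int.fract t : ℝ) : ℂ)) t‖ ≤ 1 := by
    intro t
    refine (norm_indicator_le_norm_self _ _).trans ?_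
    rw [Complex.norm_real, Real.norm_eq_abs, abs_of_nonneg (Int.fract_nonneg t)]
    exact (Int.fract_lt_one t).le
  have h : DifferentiableAt ℂ
      (mellin (Set.indicator (Set.Ioi 1) fun t : ℝ ↦ ((Int.fract t : ℝ) : ℂ))) (-s) := by
    refine mellin_differentiableAt_of_isBigO_rpow (a := 0) (b := -s.re - 1) ?_ ?_ ?_ ?_ ?_
    · refine MeasureTheory.LocallyIntegrable.locallyIntegrableOn ?_ _
      refine (MeasureTheory.locallyIntegrable_const (1 : ℝ)).mono ?_ (.of_forall ?_)
      · exact ((Complex.measurable_ofReal.comp measurable_fract).indicator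
          measurableSet_Ioi).aestronglyMeasurable
      · simpa using hb
    · exact Asymptotics.isBigO_of_le _ fun t ↦ (hb t).trans (by simp)
    · simpa using hs
    · refine Asymptotics.IsBigO.congr' (Asymptotics.isBigO_zero _ _) ?_ Filter.EventuallyEq.rfl
      filter_upwards [nhdsWithin_le_nhds (Iio_mem_nhds (zero_lt_one' ℝ))] with t ht
      rw [Set.indicator_of_notMem (by simpa using ht.le)]
    · simp
  exact h.comp s differentiableAt_id.neg

lemma riemannZeta_eq_fractIntegral {s : ℂ} (hs : 1 < s.re) :
    riemannZeta s = s / (s - 1) - s * fractIntegral s := by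
  have hs1 : s - 1 ≠ 0 := fun h ↦ by
    rw [sub_eq_zero] at h; simp [h] at hs
  rw [← LSeries_one_eq_riemannZeta hs]
  have h := LSeries_eq_mul_integral_of_nonneg (fun _ ↦ 1) zero_le_one hs
    (Asymptotics.isBigO_of_le _ (by simp)) (by simp)
  have e : (fun _ : ℕ ↦ ((1 : ℝ) : ℂ)) = 1 := by ext; simp
  rw [e] at h
  rw [h, fractIntegral_eq]
  have hi := integral_Ioi_cpow_of_lt (a := -s) (by simpa using hs) one_pos
  have hint : MeasureTheory.IntegrableOn (fun t : ℝ ↦ (t : ℂ) ^ (-s)) (Set.Ioi 1) :=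
    integrableOn_Ioi_cpow_of_lt (by simpa using hs) one_pos
  have hval : s / (s - 1) = s * ∫ t in Set.Ioi (1 : ℝ), (t : ℂ) ^ (-s) := by
    rw [hi]
    have : -s + 1 ≠ 0 := by rwa [neg_add_eq_sub, ← neg_sub, neg_ne_zero]
    simp
    grind
  rw [hval, ← mul_sub, ← MeasureTheory.integral_sub hint
    (integrableOn_fract_mul_cpow (by linarith))]
  congr 1
  refine MeasureTheory.setIntegral_congr_fun measurableSet_Ioi fun t ht ↦ ?_
  have ht0 : (0 : ℝ) < t := zero_lt_one.trans ht
  have htc : (t : ℂ) ≠ 0 := by exact_mod_cast ht0.ne'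
  have h1 : (t : ℂ) ^ (-s) = t * (t : ℂ) ^ (-(s + 1)) := by
    conv_lhs => rw [show -s = 1 + -(s + 1) by ring, Complex.cpow_add _ _ htc, Complex.cpow_one]
  have h2 : ((Int.fract t : ℝ) : ℂ) = t - (⌊t⌋₊ : ℂ) := by
    have : Int.fract t = t - (⌊t⌋₊ : ℝ) := by
      rw [Int.fract, ← natCast_floor_eq_intCast_floor ht0.le]
    rw [this]; push_cast; rfl
  simp only [h1, h2]
  simp
  ring

lemma riemannZeta₁_eq_fractIntegral {s : ℂ} (hs : 0 < s.re) :
    riemannZeta₁ s = s - s * (s - 1) * fractIntegral s := by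
  have hopen : IsOpen {s : ℂ | 0 < s.re} := isOpen_lt continuous_const Complex.continuous_re
  have key := AnalyticOnNhd.eqOn_of_preconnected_of_eventuallyEq (𝕜 := ℂ)
    (f := riemannZeta₁) (g := fun s ↦ s - s * (s - 1) * fractIntegral s)
    (U := {s : ℂ | 0 < s.re}) (z₀ := 2)
    (differentiable_riemannZeta₁.differentiableOn.analyticOnNhd hopen)
    (DifferentiableOn.analyticOnNhd (fun s hs ↦ by
      have := differentiableAt_fractIntegral hs
      exact DifferentiableAt.differentiableWithinAt (by fun_prop)) hopen)
    (convex_halfSpace_re_gt 0).isPreconnected (by simp) ?_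
  · exact key hs
  · filter_upwards [(isOpen_lt continuous_const Complex.continuous_re).mem_nhds
      (show (1 : ℝ) < (2 : ℂ).re by simp)] with z hz
    have hz1 : z ≠ 1 := by rintro rfl; simp at hz
    have h := riemannZeta_eq_fractIntegral hz
    rw [riemannZeta_eq_inv_sub_mul hz1] at h
    have := sub_ne_zero.2 hz1
    field_simp at h
    linear_combination h

lemma norm_riemannZeta₁_le {s : ℂ} (hs : 0 < s.re) :
    ‖riemannZeta₁ s‖ ≤ ‖s‖ * (1 + ‖s - 1‖ / s.re) := by
  rw [riemannZeta₁_eq_fractIntegral hs,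
    show s - s * (s - 1) * fractIntegral s = s * (1 - (s - 1) * fractIntegral s) by ring, norm_mul]
  gcongr
  refine (norm_sub_le _ _).trans ?_
  rw [norm_one, norm_mul, div_eq_mul_one_div]
  gcongr
  exact norm_fractIntegral_le hs

lemma norm_inv_riemannZeta_le {s : ℂ} (hs : 1 < s.re) :
    ‖(riemannZeta s)⁻¹‖ ≤ 2 + 1 / (s.re - 1) := by
  have hre : 1 < ((s.re : ℝ) : ℂ).re := by simpa using hs
  have h1 : (riemannZeta s)⁻¹ = LSeries (fun n ↦ (ArithmeticFunction.moebius n : ℂ)) s := by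
    have := ArithmeticFunction.LSeries_zeta_mul_Lseries_moebius hs
    rw [ArithmeticFunction.LSeries_zeta_eq_riemannZeta hs] at this
    exact inv_eq_of_mul_eq_one_right this
  have hz : riemannZeta (s.re : ℂ) = ((∑' n : ℕ, 1 / (n : ℝ) ^ s.re : ℝ) : ℂ) := by
    rw [zeta_eq_tsum_one_div_nat_cpow hre]
    push_cast
    congr 1 with n
    rw [Complex.ofReal_cpow n.cast_nonneg]
    simp
  have h2 : ‖(riemannZeta s)⁻¹‖ ≤ ‖riemannZeta (s.re : ℂ)‖ := by
    rw [h1, hz, Complex.norm_real, Real.norm_eq_abs]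
    refine le_trans ?_ (le_abs_self _)
    rw [LSeries]
    refine tsum_of_norm_bounded (Real.summable_one_div_nat_rpow.2 hs).hasSum fun n ↦ ?_
    rw [LSeries.norm_term_eq]
    split_ifs with hn
    · positivity
    · gcongr
      have := ArithmeticFunction.abs_moebius_le_one (n := n)
      rw [Complex.norm_intCast]
      exact_mod_cast this
  refine h2.trans ?_
  have hne : (s.re : ℂ) ≠ 1 := by
    intro h; rw [h] at hre; simp at hre
  rw [riemannZeta_eq_inv_sub_mul hne, norm_mul]
  have h3 := norm_riemannZeta₁_le (s := (s.re : ℂ)) (by simp; linarith)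
  have h4 : ‖(s.re : ℂ) - 1‖ = s.re - 1 := by
    rw [← Complex.ofReal_one, ← Complex.ofReal_sub, Complex.norm_real, Real.norm_of_nonneg]
    linarith
  have h5 : ‖(s.re : ℂ)‖ = s.re := by
    rw [Complex.norm_real, Real.norm_of_nonneg]; linarith
  rw [h4, h5, Complex.ofReal_re] at h3
  have hp : 0 < s.re - 1 := by linarith
  rw [norm_inv, h4]
  have h6 : s.re * (1 + (s.re - 1) / s.re) = 2 * s.re - 1 := by
    field_simp [(by linarith : s.re ≠ 0)]; ring
  rw [h6] at h3
  calc (s.re - 1)⁻¹ * ‖riemannZeta₁ (s.re : ℂ)‖ ≤ (s.re - 1)⁻¹ * (2 * s.re - 1) := by gcongr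
    _ = 2 + 1 / (s.re - 1) := by field_simp; ring

lemma differentiable_xi : Differentiable ℂ xi := by
  unfold xi
  have := differentiable_completedZeta₀
  fun_prop

lemma xi_one_sub (s : ℂ) : xi (1 - s) = xi s := by
  rw [xi, xi, completedRiemannZeta₀_one_sub]
  ring

lemma xi_one : xi 1 = 1 / 2 := by simp [xi]

lemma xi_eq {s : ℂ} (hs : 0 < s.re) : xi s = s / 2 * Gammaℝ s * riemannZeta₁ s := by
  have hs0 : s ≠ 0 := by rintro rfl; simp at hs
  rcases eq_or_ne s 1 with rfl | hs1
  · simp [xi_one]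
  have h := riemannZeta_def_of_ne_zero hs0
  have hG := Gammaℝ_ne_zero_of_re_pos hs
  have h1 := sub_ne_zero.2 hs1
  have h2 : (1 : ℂ) - s ≠ 0 := sub_ne_zero.2 hs1.symm
  rw [riemannZeta_eq_inv_sub_mul hs1, completedRiemannZeta_eq] at h
  have h3 : riemannZeta₁ s = (s - 1) * ((completedRiemannZeta₀ s - 1 / s - 1 / (1 - s))
      / Gammaℝ s) := by
    rw [← h]; field_simp
  rw [h3, xi]
  field_simp
  ring

lemma riemannZeta₁_ne_zero {s : ℂ} (hs : 1 ≤ s.re) : riemannZeta₁ s ≠ 0 := by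
  rcases eq_or_ne s 1 with rfl | hs1
  · simp
  have h := riemannZeta_ne_zero_of_one_le_re hs
  rw [riemannZeta_eq_inv_sub_mul hs1] at h
  exact right_ne_zero_of_mul h

lemma xi_ne_zero {s : ℂ} (hs : 1 ≤ s.re) : xi s ≠ 0 := by
  have hs' : 0 < s.re := by linarith
  rw [xi_eq hs']
  refine mul_ne_zero (mul_ne_zero (div_ne_zero ?_ two_ne_zero) (Gammaℝ_ne_zero_of_re_pos hs'))
    (riemannZeta₁_ne_zero hs)
  rintro rfl; simp at hs'

open ComplexConjugate in
lemma riemannZeta₁_conj (s : ℂ) : riemannZeta₁ (conj s) = conj (riemannZeta₁ s) := by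
  rcases eq_or_ne s 1 with rfl | hs1
  · simp
  have hs1' : conj s ≠ 1 := fun h ↦ hs1 (by simpa using congrArg conj h)
  have h := riemannZeta_conj s
  rw [riemannZeta_eq_inv_sub_mul hs1, riemannZeta_eq_inv_sub_mul hs1'] at h
  have h1 := sub_ne_zero.2 hs1'
  simp only [map_mul, map_inv₀, map_sub, map_one] at h
  exact mul_left_cancel₀ (inv_ne_zero h1) h

open ComplexConjugate in
lemma Gammaℝ_conj (s : ℂ) : Gammaℝ (conj s) = conj (Gammaℝ s) := by
  have hpi : Complex.arg (Real.pi : ℂ) ≠ Real.pi := by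
    rw [Complex.arg_ofReal_of_nonneg Real.pi_pos.le]; exact Real.pi_ne_zero.symm
  have h2 : ∀ z : ℂ, conj z / 2 = conj (z / 2) := fun z ↦ by rw [map_div₀, map_ofNat]
  rw [Gammaℝ_def, Gammaℝ_def, map_mul, ← Complex.Gamma_conj, ← map_neg, h2, h2,
    Complex.cpow_conj _ _ hpi, Complex.conj_ofReal]

open ComplexConjugate in
lemma xi_conj {s : ℂ} (hs : 0 < s.re) : xi (conj s) = conj (xi s) := by
  rw [xi_eq hs, xi_eq (by simpa using hs), riemannZeta₁_conj, Gammaℝ_conj, map_mul, map_mul, map_div₀,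
    map_ofNat]

/-- The quotient `ξ(w) / ξ(w + 1)`. -/
noncomputable def xiQuotient (w : ℂ) : ℂ := xi w / xi (w + 1)

lemma differentiableAt_xiQuotient {w : ℂ} (hw : 0 ≤ w.re) :
    DifferentiableAt ℂ xiQuotient w := by
  have := differentiable_xi
  unfold xiQuotient
  have h : xi (w + 1) ≠ 0 := xi_ne_zero (by simpa using hw)
  exact DifferentiableAt.fun_div (by fun_prop) (by fun_prop) h

open ComplexConjugate in
lemma norm_xiQuotient_of_re_eq_zero {w : ℂ} (hw : w.re = 0) : ‖xiQuotient w‖ = 1 := by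
  have h : xi w = conj (xi (w + 1)) := by
    rw [← xi_conj (by simp [hw]), ← xi_one_sub w]
    congr 1
    apply Complex.ext <;> simp [hw]
  rw [xiQuotient, norm_div, h, Complex.norm_conj]
  exact div_self (norm_ne_zero_iff.2 (xi_ne_zero (by simp [hw])))

lemma norm_betaIntegral_half_le {u : ℂ} (hu : 1 ≤ u.re) : ‖betaIntegral u (1 / 2)‖ ≤ 2 := by
  have hint : IntervalIntegrable (fun x : ℝ ↦ (1 - x) ^ (-1 / 2 : ℝ)) MeasureTheory.volume 0 1 := by
    have := (intervalIntegral.intervalIntegrable_rpow' (a := 0) (b := 1) (r := -1 / 2)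
      (by norm_num)).comp_sub_left 1
    simpa using this.symm
  have hval : ∫ x in (0 : ℝ)..1, (1 - x) ^ (-1 / 2 : ℝ) = 2 := by
    rw [intervalIntegral.integral_comp_sub_left (fun x : ℝ ↦ x ^ (-1 / 2 : ℝ)),
      integral_rpow (Or.inl (by norm_num))]
    norm_num
  rw [← hval, betaIntegral]
  refine intervalIntegral.norm_integral_le_of_norm_le zero_le_one (.of_forall fun x hx ↦ ?_) hint
  rcases hx.2.eq_or_lt with rfl | hx1
  · norm_num
  · rw [norm_mul, Complex.norm_cpow_eq_rpow_re_of_pos hx.1,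
      show (1 : ℂ) - x = ((1 - x : ℝ) : ℂ) by push_cast; rfl,
      Complex.norm_cpow_eq_rpow_re_of_pos (sub_pos.2 hx1),
      show ((1 / 2 : ℂ) - 1).re = -1 / 2 by norm_num]
    refine mul_le_of_le_one_left (Real.rpow_nonneg (sub_nonneg.2 hx.2) _)
      (Real.rpow_le_one hx.1.le hx.2 ?_)
    simpa using hu

lemma norm_xiQuotient_le_riemannZeta₁ {w : ℂ} (hw : 0 < w.re) :
    ‖xiQuotient w‖ ≤ 2 * ‖riemannZeta₁ w‖ * ‖(riemannZeta₁ (w + 1))⁻¹‖ := by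
  have hw0 : w ≠ 0 := by rintro rfl; simp at hw
  have hw1 : 0 < (w + 1).re := by simp; linarith
  have hw10 : w + 1 ≠ 0 := by rintro h; simp [h] at hw1
  have hG : Gammaℝ w = betaIntegral (w / 2 + 1) (1 / 2) * ((w + 1) / w) * Gammaℝ (w + 1) := by
    have hb := betaIntegral_eq_Gamma_mul_div (w / 2 + 1) (1 / 2)
      (by simp; linarith) (by simp)
    have h1 : Gamma (w / 2 + 1) = w / 2 * Gamma (w / 2) := Complex.Gamma_add_one _ (by simpa)
    have h2 : Gamma (w / 2 + 1 + 1 / 2) = (w + 1) / 2 * Gamma ((w + 1) / 2) := by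
      rw [← Complex.Gamma_add_one _ (by simpa)]; ring_nf
    have h3 : Gamma ((w + 1) / 2) ≠ 0 := Complex.Gamma_ne_zero_of_re_pos (by simp; linarith)
    have hpi : (Real.pi : ℂ) ≠ 0 := by exact_mod_cast Real.pi_ne_zero
    have h4 : (Real.pi : ℂ) ^ (-w / 2) = Real.pi ^ (-(w + 1) / 2) * Real.pi ^ (1 / 2 : ℂ) := by
      rw [← Complex.cpow_add _ _ hpi]; ring_nf
    rw [hb, h1, h2, Gammaℝ_def, Gammaℝ_def, h4, Complex.Gamma_one_half_eq]
    field_simp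
  have hne := riemannZeta₁_ne_zero (s := w + 1) (by simpa using hw.le)
  have hGne := Gammaℝ_ne_zero_of_re_pos hw1
  have heq : xiQuotient w = betaIntegral (w / 2 + 1) (1 / 2) * riemannZeta₁ w *
      (riemannZeta₁ (w + 1))⁻¹ := by
    rw [xiQuotient, xi_eq hw, xi_eq hw1, hG]
    field_simp
  rw [heq, norm_mul, norm_mul]
  gcongr
  exact norm_betaIntegral_half_le (by simp; linarith)

lemma norm_xiQuotient_le {w : ℂ} (hw : 0 < w.re) :
    ‖xiQuotient w‖ ≤ 2 * (1 + ‖w - 1‖ / w.re) * (2 + 1 / w.re) := by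
  have hw0 : w ≠ 0 := by rintro rfl; simp at hw
  refine (norm_xiQuotient_le_riemannZeta₁ hw).trans ?_
  have h1 := norm_riemannZeta₁_le hw
  have h2 := norm_inv_riemannZeta_le (s := w + 1) (by simpa using hw)
  have h3 : (riemannZeta₁ (w + 1))⁻¹ = w⁻¹ * (riemannZeta (w + 1))⁻¹ := by
    rw [riemannZeta_eq_inv_sub_mul (by simpa using hw0)]
    field_simp
    simp
  simp only [add_re, one_re, add_sub_cancel_right] at h2
  have hn : 0 < ‖w‖ := norm_pos_iff.2 hw0
  rw [h3, norm_mul, norm_inv]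
  calc 2 * ‖riemannZeta₁ w‖ * (‖w‖⁻¹ * ‖(riemannZeta (w + 1))⁻¹‖)
      ≤ 2 * (‖w‖ * (1 + ‖w - 1‖ / w.re)) * (‖w‖⁻¹ * (2 + 1 / w.re)) := by gcongr
    _ = _ := by field_simp

lemma norm_xiQuotient_mul_le {w : ℂ} {R : ℝ} (hR : 1 ≤ R) (hw : 0 ≤ w.re) (hwR : ‖w‖ = R) :
    ‖xiQuotient w * ((w ^ 2 + R ^ 2) / R ^ 2) ^ 2‖ ≤ 72 := by
  have hR0 : 0 < R := by linarith
  have hfac : ‖(w ^ 2 + (R : ℂ) ^ 2) / (R : ℂ) ^ 2‖ = 2 * w.re / R := by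
    have h1 : w ^ 2 + (R : ℂ) ^ 2 = 2 * w.re * w := by
      have h2 : w * (starRingEnd ℂ) w = (R : ℂ) ^ 2 := by
        rw [Complex.mul_conj', hwR]
      have h3 := Complex.add_conj w
      push_cast at h3
      rw [← h2, ← h3]; ring
    rw [h1]
    simp only [norm_div, norm_mul, norm_pow, Complex.norm_real, Complex.norm_ofNat, hwR]
    rw [Real.norm_of_nonneg hw, Real.norm_of_nonneg hR0.le]
    field_simp
  rw [norm_mul, norm_pow, hfac]
  rcases hw.eq_or_lt with h0 | hpos
  · rw [← h0]; norm_num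
  have h1 := norm_xiQuotient_le hpos
  have h2 : ‖w - 1‖ ≤ R + 1 := (norm_sub_le _ _).trans (by simp [hwR])
  have h3 : w.re ≤ R := (Complex.re_le_norm w).trans hwR.le
  have h4 : ‖xiQuotient w‖ ≤ 2 * (1 + (R + 1) / w.re) * (2 + 1 / w.re) := h1.trans (by gcongr)
  set x := w.re
  calc ‖xiQuotient w‖ * (2 * x / R) ^ 2
      ≤ (2 * (1 + (R + 1) / x) * (2 + 1 / x)) * (2 * x / R) ^ 2 := by gcongr
    _ = 8 * (((x + R + 1) / R) * ((2 * x + 1) / R)) := by field_simp; ring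
    _ ≤ 8 * (3 * 3) := by
        gcongr
        · rw [div_le_iff₀ hR0]; linarith
        · rw [div_le_iff₀ hR0]; linarith
    _ = 72 := by norm_num

lemma norm_xiQuotient_le_const {z : ℂ} (hz : 0 < z.re) : ‖xiQuotient z‖ ≤ 128 := by
  set R : ℝ := max 1 (2 * ‖z‖)
  have hR : 1 ≤ R := le_max_left _ _
  have hzR : 2 * ‖z‖ ≤ R := le_max_right _ _
  have hR0 : 0 < R := by linarith
  have hzpos : 0 < ‖z‖ := hz.trans_le (Complex.re_le_norm z)
  set U : Set ℂ := Metric.ball 0 R ∩ {w | 0 < w.re}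
  have hre : IsOpen {w : ℂ | 0 < w.re} := isOpen_lt continuous_const Complex.continuous_re
  have hU : IsOpen U := Metric.isOpen_ball.inter hre
  have hcl : closure U ⊆ Metric.closedBall 0 R ∩ {w | 0 ≤ w.re} :=
    closure_minimal (Set.inter_subset_inter Metric.ball_subset_closedBall
      fun w (hw : 0 < w.re) ↦ hw.le)
      (Metric.isClosed_closedBall.inter (isClosed_le continuous_const Complex.continuous_re))
  have hd : DiffContOnCl ℂ (fun w ↦ xiQuotient w * ((w ^ 2 + (R : ℂ) ^ 2) / R ^ 2) ^ 2) U := by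
    refine DifferentiableOn.diffContOnCl fun w hw ↦ DifferentiableAt.differentiableWithinAt ?_
    have := differentiableAt_xiQuotient (hcl hw).2
    fun_prop
  have hRn : ‖(R : ℂ) ^ 2‖ = R ^ 2 := by
    rw [norm_pow, Complex.norm_real, Real.norm_of_nonneg hR0.le]
  have hbound := Complex.norm_le_of_forall_mem_frontier_norm_le
    (Metric.isBounded_ball.subset Set.inter_subset_left) hd (C := 72) (fun w hw ↦ ?_)
    (subset_closure (show z ∈ U from ⟨by simp; linarith, hz⟩))
  · rw [norm_mul, norm_pow, norm_div, hRn] at hbound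
    have h1 : 3 / 4 ≤ ‖z ^ 2 + (R : ℂ) ^ 2‖ / R ^ 2 := by
      rw [le_div_iff₀ (by positivity)]
      have := norm_sub_le_norm_add ((R : ℂ) ^ 2) (z ^ 2)
      rw [hRn, norm_pow, add_comm] at this
      nlinarith
    have h2 : (3 / 4 : ℝ) ^ 2 ≤ (‖z ^ 2 + (R : ℂ) ^ 2‖ / R ^ 2) ^ 2 := by gcongr
    have := mul_le_mul_of_nonneg_left h2 (norm_nonneg (xiQuotient z))
    linarith
  · obtain ⟨hwb, hw0⟩ := hcl hw.1
    have hwb : ‖w‖ ≤ R := by simpa using hwb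
    rcases hwb.eq_or_lt with heq | hlt
    · exact norm_xiQuotient_mul_le hR hw0 heq
    · have hw0' : w.re = 0 := by
        refine le_antisymm (not_lt.1 fun h ↦ ?_) hw0
        rw [hU.frontier_eq] at hw
        exact hw.2 ⟨by simpa using hlt, h⟩
      rw [norm_mul, norm_xiQuotient_of_re_eq_zero hw0', one_mul, norm_pow, norm_div, hRn]
      have h1 : ‖w ^ 2 + (R : ℂ) ^ 2‖ / R ^ 2 ≤ 2 := by
        rw [div_le_iff₀ (by positivity)]
        refine (norm_add_le _ _).trans ?_
        rw [hRn, norm_pow]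
        have := pow_le_pow_left₀ (norm_nonneg w) hwb 2
        linarith
      calc _ ≤ (2 : ℝ) ^ 2 := by gcongr
        _ ≤ 72 := by norm_num

lemma diffContOnCl_xiQuotient : DiffContOnCl ℂ xiQuotient {z | 0 < z.re} :=
  DifferentiableOn.diffContOnCl fun w hw ↦ by
    rw [Complex.closure_setOfPred_lt_re] at hw
    exact (differentiableAt_xiQuotient hw).differentiableWithinAt

lemma norm_xiQuotient_le_one {z : ℂ} (hz : 0 ≤ z.re) : ‖xiQuotient z‖ ≤ 1 := by
  refine PhragmenLindelof.right_half_plane_of_bounded_on_real diffContOnCl_xiQuotient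
    ⟨1, one_lt_two, 0, ?_⟩ ?_ (fun x ↦ (norm_xiQuotient_of_re_eq_zero (by simp)).le) hz
  · refine Asymptotics.IsBigO.of_bound 128 (Filter.mem_inf_of_right fun w hw ↦ ?_)
    simpa using norm_xiQuotient_le_const hw
  · exact ⟨128, Filter.eventually_map.2 ((Filter.eventually_gt_atTop 0).mono fun x hx ↦
      norm_xiQuotient_le_const (by simpa using hx))⟩

lemma xi_two : xi 2 = Real.pi / 6 := by
  have hpi : (Real.pi : ℂ) ≠ 0 := by exact_mod_cast Real.pi_ne_zero
  have h : riemannZeta₁ 2 = Real.pi ^ 2 / 6 := by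
    have := riemannZeta_eq_inv_sub_mul (s := 2) (by norm_num)
    rw [riemannZeta_two] at this
    rw [this]; norm_num
  rw [xi_eq (by simp), h, Gammaℝ_def]
  norm_num [Complex.cpow_neg]
  field_simp

lemma xiQuotient_ne_neg_one {w : ℂ} (hw : 0 < w.re) : xiQuotient w ≠ -1 := by
  intro h
  have hmax : IsMaxOn (norm ∘ xiQuotient) {z | 0 < z.re} w := fun z hz ↦ by
    simpa [h] using norm_xiQuotient_le_one (le_of_lt hz)
  have key := Complex.eqOn_of_isPreconnected_of_isMaxOn_norm
    (convex_halfSpace_re_gt 0).isPreconnected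
    (isOpen_lt continuous_const Complex.continuous_re) diffContOnCl_xiQuotient.differentiableOn
    hw hmax (show (1 : ℂ) ∈ {z : ℂ | 0 < z.re} by simp)
  have hpi : (Real.pi : ℂ) ≠ 0 := by exact_mod_cast Real.pi_ne_zero
  rw [Function.const_apply, h, xiQuotient, one_add_one_eq_two, xi_one, xi_two] at key
  field_simp at key
  have : (3 : ℝ) = -Real.pi := by
    apply Complex.ofReal_injective
    push_cast
    linear_combination key / 2
  linarith [Real.pi_pos]

lemma xi_add_xi_ne_zero {s : ℂ} (hs : 1 / 2 < s.re) : xi (s + 1 / 2) + xi (s - 1 / 2) ≠ 0 := by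
  intro h
  have hw : 0 < (s - 1 / 2).re := by simp; linarith
  apply xiQuotient_ne_neg_one hw
  have hne : xi (s - 1 / 2 + 1) ≠ 0 := xi_ne_zero (by simp at hw ⊢; linarith)
  rw [xiQuotient, div_eq_iff hne]
  have : s - 1 / 2 + 1 = s + 1 / 2 := by ring
  rw [this]
  linear_combination h

/-- The Lagarias–Suzuki / Ki theorem: every zero of `ξ₊` lies on the critical line
`Re s = 1/2`. -/
theorem xiPlus_zeros_on_critical_line :
    ∀ s : ℂ, xiPlus s = 0 → s.re = 1 / 2 := by
  intro s h
  have h' : xi (s + 1 / 2) + xi (s - 1 / 2) = 0 := by simpa [xiPlus] using h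
  rcases lt_trichotomy s.re (1 / 2) with hlt | heq | hgt
  · refine absurd ?_ (xi_add_xi_ne_zero (s := 1 - s) (by simp; linarith))
    rw [← xi_one_sub (1 - s + 1 / 2), ← xi_one_sub (1 - s - 1 / 2), ← h']
    ring_nf
  · exact heq
  · exact absurd h' (xi_add_xi_ne_zero hgt)
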